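/- Let A_1,…,A_m be d×d positive semidefinite matrices and let ξ_1,…,ξ_m be jointly independent real-valued random variables each taking only finitely many values. Define the random polynomial f_{ξ_1,…,ξ_m}(x) = μ[ξ_1 A_1,…,ξ_m A_m](x)·μ[−ξ_1 A_1,…,−ξ_m A_m](x). Then E[f_{ξ_1,…,ξ_m}] is a real-rooted monic polynomial of degree 2d. Moreover, if E[ξ_i] = 0 for all i, then E[f_{ξ_1,…,ξ_m}] = μ₂[ Var(ξ_1)^{1/2} A_1, …, Var(ξ_m)^{1/2} A_m ]. -/

import Mathlib

open scoped ComplexOrder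

/-- The mixed characteristic polynomial
`μ[A_1,…,A_m](x) = ∏ (1 − ∂_{z_i}) det(x I + Σ z_i A_i) |_{z=0}`. -/
noncomputable def mixedCharPoly {m d : ℕ} (A : Fin m → Matrix (Fin d) (Fin d) ℂ) :
    Polynomial ℂ :=
  MvPolynomial.eval (fun _ => (0 : Polynomial ℂ))
    ((List.ofFn fun i : Fin m =>
        ((1 : Module.End (Polynomial ℂ) (MvPolynomial (Fin m) (Polynomial ℂ))) -
          (MvPolynomial.pderiv i).toLinearMap :
          Module.End (Polynomial ℂ) (MvPolynomial (Fin m) (Polynomial ℂ)))).prod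
      (Matrix.det (Matrix.of fun a b =>
        MvPolynomial.C Polynomial.X * (if a = b then 1 else 0) +
          ∑ i, MvPolynomial.X i * MvPolynomial.C (Polynomial.C (A i a b)))))

/-- The quadratic mixed characteristic polynomial
`μ₂[B_1,…,B_m](x) = ∏ (1 − ∂_{z_i}∂_{w_i}) [det(x I + Σ z_i B_i)·det(x I + Σ w_i B_i)]`
evaluated at `z = w = 0`. -/
noncomputable def quadMixedCharPoly {m d : ℕ} (B : Fin m → Matrix (Fin d) (Fin d) ℂ) :
    Polynomial ℂ :=
  MvPolynomial.eval (fun _ => (0 : Polynomial ℂ))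
    ((List.ofFn fun i : Fin m =>
        ((1 : Module.End (Polynomial ℂ) (MvPolynomial (Fin m ⊕ Fin m) (Polynomial ℂ))) -
          ((MvPolynomial.pderiv (Sum.inl i)).toLinearMap ∘ₗ
            (MvPolynomial.pderiv (Sum.inr i)).toLinearMap) :
          Module.End (Polynomial ℂ) (MvPolynomial (Fin m ⊕ Fin m) (Polynomial ℂ)))).prod
      (Matrix.det (Matrix.of fun a b =>
          MvPolynomial.C Polynomial.X * (if a = b then 1 else 0) +
            ∑ i, MvPolynomial.X (Sum.inl i) * MvPolynomial.C (Polynomial.C (B i a b))) *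
       Matrix.det (Matrix.of fun a b =>
          MvPolynomial.C Polynomial.X * (if a = b then 1 else 0) +
            ∑ i, MvPolynomial.X (Sum.inr i) * MvPolynomial.C (Polynomial.C (B i a b)))))

/-- A polynomial (with complex coefficients) is real-rooted if all its roots are real. -/
def RealRooted (p : Polynomial ℂ) : Prop := ∀ z : ℂ, p.IsRoot z → z.im = 0

section Auxiliary

open MvPolynomial Finset

section Expansion

variable {ι R V : Type*} [DecidableEq ι] [CommRing R] [AddCommGroup V] [Module R V]

/-- Expansion of `∏ (1 + c_i D_i)` under a family of functionals `φ T` satisfying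
`φ T ∘ D_i = φ (insert i T)` for `i ∉ T`. -/
theorem expand_prod_one_add_smul (D : ι → Module.End R V) (c : ι → R)
    (φ : Finset ι → V →ₗ[R] R) (hφ : ∀ T i, i ∉ T → ∀ r, φ T (D i r) = φ (insert i T) r)
    (l : List ι) (hl : l.Nodup) (T : Finset ι) (hT : ∀ i ∈ l, i ∉ T) (r : V) :
    φ T ((l.map fun i => 1 + c i • D i).prod r) =
      ∑ U ∈ l.toFinset.powerset, (∏ i ∈ U, c i) * φ (T ∪ U) r := by
  induction l generalizing T with
  | nil => simp
  | cons a l ih =>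
    obtain ⟨hal, hl⟩ := List.nodup_cons.1 hl
    have haT : a ∉ T := hT a (by simp)
    have hal' : a ∉ l.toFinset := by simpa using hal
    simp only [List.map_cons, List.prod_cons, List.toFinset_cons, Module.End.mul_apply,
      LinearMap.add_apply, LinearMap.smul_apply, Module.End.one_apply, map_add, map_smul,
      smul_eq_mul]
    rw [hφ T a haT, ih hl T (fun i hi => hT i (by simp [hi])),
      ih hl (insert a T) (fun i hi => by
        rw [Finset.mem_insert, not_or]
        exact ⟨fun h => hal (h ▸ hi), hT i (by simp [hi])⟩),
      Finset.sum_powerset_insert hal', Finset.mul_sum]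
    congr 1
    refine Finset.sum_congr rfl fun U hU => ?_
    have haU : a ∉ U := fun h => hal' (Finset.mem_powerset.1 hU h)
    rw [Finset.prod_insert haU, mul_assoc, Finset.insert_union, Finset.union_insert]

theorem expand_ofFn_prod {m : ℕ} (D : Fin m → Module.End R V) (c : Fin m → R)
    (φ : Finset (Fin m) → V →ₗ[R] R)
    (hφ : ∀ T i, i ∉ T → ∀ r, φ T (D i r) = φ (insert i T) r) (r : V) :
    φ ∅ ((List.ofFn fun i => 1 + c i • D i).prod r) =
      ∑ U, (∏ i ∈ U, c i) * φ U r := by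
  rw [List.ofFn_eq_map, expand_prod_one_add_smul D c φ hφ _ (List.nodup_finRange m) ∅ (by simp)]
  simp

theorem expand_ofFn_prod_one_sub {m : ℕ} (D : Fin m → Module.End R V)
    (φ : Finset (Fin m) → V →ₗ[R] R)
    (hφ : ∀ T i, i ∉ T → ∀ r, φ T (D i r) = φ (insert i T) r) (r : V) :
    φ ∅ ((List.ofFn fun i => 1 - D i).prod r) =
      ∑ U, (∏ _i ∈ U, (-1 : R)) * φ U r := by
  rw [← expand_ofFn_prod D (fun _ => -1) φ hφ r]
  simp only [neg_smul, one_smul, ← sub_eq_add_neg]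

end Expansion

/-- The exponent of the squarefree monomial with support `T`. -/
noncomputable def sqfreeExp {ι : Type*} (T : Finset ι) : ι →₀ ℕ :=
  ∑ i ∈ T, Finsupp.single i 1

theorem sqfreeExp_apply {ι : Type*} [DecidableEq ι] (T : Finset ι) (j : ι) :
    sqfreeExp T j = if j ∈ T then 1 else 0 := by
  simp [sqfreeExp, Finsupp.finsetSum_apply, Finsupp.single_apply]

theorem sqfreeExp_insert {ι : Type*} [DecidableEq ι] {T : Finset ι} {i : ι} (h : i ∉ T) :
    sqfreeExp (insert i T) = sqfreeExp T + Finsupp.single i 1 := by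
  rw [sqfreeExp, Finset.sum_insert h, add_comm, sqfreeExp]

section Coeffs

variable {R : Type*} [CommRing R]

theorem coeff_sqfreeExp_pderiv {ι : Type*} [DecidableEq ι] (T : Finset ι) (i : ι)
    (h : i ∉ T) (r : MvPolynomial ι R) :
    coeff (sqfreeExp T) (pderiv i r) = coeff (sqfreeExp (insert i T)) r := by
  rw [coeff_pderiv, sqfreeExp_insert h, sqfreeExp_apply, if_neg h]
  simp

/-- The exponent of the monomial `∏_{i ∈ T} z_i w_i`. -/
noncomputable def doubleExp {ι : Type*} (T : Finset ι) : ι ⊕ ι →₀ ℕ :=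
  (sqfreeExp T).mapDomain Sum.inl + (sqfreeExp T).mapDomain Sum.inr

theorem mapDomain_inl_apply_inr {ι κ : Type*} (f : ι →₀ ℕ) (j : κ) :
    f.mapDomain (Sum.inl : ι → ι ⊕ κ) (Sum.inr j) = 0 :=
  Finsupp.mapDomain_of_notMem_range _ _ (by simp)

theorem mapDomain_inr_apply_inl {ι κ : Type*} (f : κ →₀ ℕ) (j : ι) :
    f.mapDomain (Sum.inr : κ → ι ⊕ κ) (Sum.inl j) = 0 :=
  Finsupp.mapDomain_of_notMem_range _ _ (by simp)

theorem coeff_doubleExp_pderiv {ι : Type*} [DecidableEq ι] (T : Finset ι) (i : ι)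
    (h : i ∉ T) (r : MvPolynomial (ι ⊕ ι) R) :
    coeff (doubleExp T) (pderiv (Sum.inl i) (pderiv (Sum.inr i) r)) =
      coeff (doubleExp (insert i T)) r := by
  have h1 : doubleExp T (Sum.inl i) = 0 := by
    rw [doubleExp, Finsupp.add_apply, mapDomain_inr_apply_inl,
      Finsupp.mapDomain_apply Sum.inl_injective, sqfreeExp_apply, if_neg h]
  have h2 : doubleExp T (Sum.inr i) = 0 := by
    rw [doubleExp, Finsupp.add_apply, mapDomain_inl_apply_inr,
      Finsupp.mapDomain_apply Sum.inr_injective, sqfreeExp_apply, if_neg h]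
  rw [coeff_pderiv, coeff_pderiv, h1, Finsupp.add_apply, h2]
  have h3 : doubleExp (insert i T) =
      doubleExp T + Finsupp.single (Sum.inl i) 1 + Finsupp.single (Sum.inr i) 1 := by
    rw [doubleExp, sqfreeExp_insert h, Finsupp.mapDomain_add, Finsupp.mapDomain_add,
      Finsupp.mapDomain_single, Finsupp.mapDomain_single, doubleExp]
    abel
  rw [h3]
  simp

theorem coeff_rename_mul_rename {ι κ : Type*} (a : ι →₀ ℕ) (b : κ →₀ ℕ)
    (p : MvPolynomial ι R) (q : MvPolynomial κ R) :
    coeff (a.mapDomain Sum.inl + b.mapDomain Sum.inr)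
      (rename (Sum.inl : ι → ι ⊕ κ) p * rename (Sum.inr : κ → ι ⊕ κ) q) =
      coeff a p * coeff b q := by
  classical
  induction p using MvPolynomial.induction_on' with
  | add p₁ p₂ h₁ h₂ => simp only [map_add, add_mul, coeff_add, h₁, h₂]
  | monomial u x =>
    induction q using MvPolynomial.induction_on' with
    | add q₁ q₂ h₁ h₂ => simp only [map_add, mul_add, coeff_add, h₁, h₂]
    | monomial v y =>
      have key : u.mapDomain (Sum.inl : ι → ι ⊕ κ) + v.mapDomain Sum.inr =
          a.mapDomain Sum.inl + b.mapDomain Sum.inr ↔ u = a ∧ v = b := by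
        constructor
        · intro h
          constructor
          · ext i
            have := DFunLike.congr_fun h (Sum.inl i)
            simpa [mapDomain_inr_apply_inl, Finsupp.mapDomain_apply Sum.inl_injective] using this
          · ext i
            have := DFunLike.congr_fun h (Sum.inr i)
            simpa [mapDomain_inl_apply_inr, Finsupp.mapDomain_apply Sum.inr_injective] using this
        · rintro ⟨rfl, rfl⟩; rfl
      rw [rename_monomial, rename_monomial, monomial_mul, coeff_monomial, coeff_monomial,
        coeff_monomial]
      simp only [key]
      by_cases h1 : u = a <;> by_cases h2 : v = b <;> simp [h1, h2]

theorem coeff_bind₁_C_mul_X {ι : Type*} [Fintype ι] (t : ι → R) (n : ι →₀ ℕ)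
    (p : MvPolynomial ι R) :
    coeff n (bind₁ (fun i => C (t i) * X i) p) = (∏ i, t i ^ n i) * coeff n p := by
  classical
  induction p using MvPolynomial.induction_on' with
  | add p₁ p₂ h₁ h₂ => simp only [map_add, mul_add, coeff_add, h₁, h₂]
  | monomial u x =>
    have : bind₁ (fun i => C (t i) * X i) (monomial u x) =
        C (∏ i, t i ^ u i) * monomial u x := by
      rw [bind₁_monomial, monomial_eq (s := u), Finsupp.prod]
      simp only [mul_pow, Finset.prod_mul_distrib, map_prod, map_pow]
      rw [Finset.prod_subset (Finset.subset_univ u.support)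
        (f := fun i => (C (t i) : MvPolynomial ι R) ^ u i)
        (fun i _ hi => by rw [Finsupp.notMem_support_iff.1 hi, pow_zero])]
      ring
    rw [this, coeff_C_mul, coeff_monomial]
    split_ifs with h
    · rw [h]
    · simp

end Coeffs

section MixedCoefficients

variable {m d : ℕ}

/-- The determinant `det(x I + ∑ z_i A_i)` as a polynomial in `z` with coefficients in `ℂ[x]`. -/
noncomputable def pencilDet (A : Fin m → Matrix (Fin d) (Fin d) ℂ) :
    MvPolynomial (Fin m) (Polynomial ℂ) :=
  Matrix.det (Matrix.of fun a b =>
    MvPolynomial.C Polynomial.X * (if a = b then 1 else 0) +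
      ∑ i, MvPolynomial.X i * MvPolynomial.C (Polynomial.C (A i a b)))

/-- The coefficient of `∏_{i ∈ T} z_i` in `det(x I + ∑ z_i A_i)`. -/
noncomputable def pencilCoeff (A : Fin m → Matrix (Fin d) (Fin d) ℂ) (T : Finset (Fin m)) :
    Polynomial ℂ :=
  coeff (sqfreeExp T) (pencilDet A)

theorem mixedCharPoly_eq_sum (A : Fin m → Matrix (Fin d) (Fin d) ℂ) :
    mixedCharPoly A = ∑ T, (∏ _i ∈ T, (-1 : Polynomial ℂ)) * pencilCoeff A T := by
  have := expand_ofFn_prod_one_sub (R := Polynomial ℂ)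
    (fun i : Fin m => (MvPolynomial.pderiv i).toLinearMap)
    (fun T => MvPolynomial.lcoeff (Polynomial ℂ) (sqfreeExp T))
    (fun T i h r => coeff_sqfreeExp_pderiv T i h r) (pencilDet A)
  rw [mixedCharPoly, eval_zero']
  exact this

theorem quadMixedCharPoly_eq_sum (A : Fin m → Matrix (Fin d) (Fin d) ℂ) :
    quadMixedCharPoly A =
      ∑ T, (∏ _i ∈ T, (-1 : Polynomial ℂ)) * (pencilCoeff A T * pencilCoeff A T) := by
  have := expand_ofFn_prod_one_sub (R := Polynomial ℂ)
    (fun i : Fin m => (MvPolynomial.pderiv (Sum.inl i : Fin m ⊕ Fin m)).toLinearMap ∘ₗ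
            (MvPolynomial.pderiv (Sum.inr i)).toLinearMap)
    (fun T => MvPolynomial.lcoeff (Polynomial ℂ) (doubleExp T))
    (fun T i h r => coeff_doubleExp_pderiv T i h r)
    (rename Sum.inl (pencilDet A) * rename Sum.inr (pencilDet A))
  have h0 : ∀ (f : Fin m → Fin m ⊕ Fin m), rename f (pencilDet A) =
      Matrix.det (Matrix.of fun a b =>
          MvPolynomial.C Polynomial.X * (if a = b then 1 else 0) +
            ∑ i, MvPolynomial.X (f i) * MvPolynomial.C (Polynomial.C (A i a b))) := by
    intro f
    rw [pencilDet, AlgHom.map_det]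
    congr 1
    ext1 a b
    simp [apply_ite (rename f)]
  rw [quadMixedCharPoly, eval_zero', ← h0, ← h0]
  refine Eq.trans ?_ (this.trans (Finset.sum_congr rfl fun T _ => ?_))
  · change coeff 0 _ = coeff (doubleExp ∅) _
    congr 1
  · congr 1
    exact coeff_rename_mul_rename _ _ _ _

theorem pencilCoeff_smul (A : Fin m → Matrix (Fin d) (Fin d) ℂ) (t : Fin m → ℂ)
    (T : Finset (Fin m)) :
    pencilCoeff (fun i => t i • A i) T = (∏ i ∈ T, Polynomial.C (t i)) * pencilCoeff A T := by
  have h : pencilDet (fun i => t i • A i) =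
      bind₁ (fun i => C (Polynomial.C (t i)) * X i) (pencilDet A) := by
    rw [pencilDet, pencilDet, AlgHom.map_det]
    congr 1
    ext1 a b
    rw [AlgHom.mapMatrix_apply, Matrix.map_apply, Matrix.of_apply, Matrix.of_apply, map_add,
      map_sum, map_mul, bind₁_C_right]
    congr 1
    · rw [apply_ite (bind₁ _), map_one, map_zero]
    · refine Finset.sum_congr rfl fun i _ => ?_
      rw [map_mul, bind₁_C_right, bind₁_X_right, Matrix.smul_apply, smul_eq_mul,
        Polynomial.C_mul, C_mul]
      ring
  rw [pencilCoeff, h, coeff_bind₁_C_mul_X, pencilCoeff]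
  congr 1
  simp [sqfreeExp_apply, Finset.prod_ite_mem, pow_ite]

/-- Polynomials in `z` over `ℂ[x]` of total degree at most `k` in `(x, z)`. -/
def TotalDegLE (k : ℕ) (q : MvPolynomial (Fin m) (Polynomial ℂ)) : Prop :=
  ∀ n j, k < j + n.degree → (coeff n q).coeff j = 0

theorem TotalDegLE.add {k : ℕ} {p q : MvPolynomial (Fin m) (Polynomial ℂ)}
    (hp : TotalDegLE k p) (hq : TotalDegLE k q) : TotalDegLE k (p + q) := fun n j h => by
  rw [coeff_add, Polynomial.coeff_add, hp n j h, hq n j h, add_zero]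

theorem TotalDegLE.mul {k l : ℕ} {p q : MvPolynomial (Fin m) (Polynomial ℂ)}
    (hp : TotalDegLE k p) (hq : TotalDegLE l q) : TotalDegLE (k + l) (p * q) := fun n j h => by
  classical
  rw [coeff_mul, Polynomial.finsetSum_coeff]
  refine Finset.sum_eq_zero fun x hx => ?_
  rw [Polynomial.coeff_mul]
  refine Finset.sum_eq_zero fun y hy => ?_
  rw [Finset.HasAntidiagonal.mem_antidiagonal] at hx hy
  rw [← hx, ← hy, map_add] at h
  by_cases h1 : k < y.1 + x.1.degree
  · rw [hp _ _ h1, zero_mul]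
  · rw [hq _ _ (by omega), mul_zero]

theorem TotalDegLE.sum {κ : Type*} {k : ℕ} (s : Finset κ)
    (f : κ → MvPolynomial (Fin m) (Polynomial ℂ)) (h : ∀ i ∈ s, TotalDegLE k (f i)) :
    TotalDegLE k (∑ i ∈ s, f i) :=
  Finset.sum_induction _ _ (fun _ _ => TotalDegLE.add) (fun n j _ => by simp) h

theorem totalDegLE_C_C {k : ℕ} (c : ℂ) :
    TotalDegLE k (C (Polynomial.C c) : MvPolynomial (Fin m) (Polynomial ℂ)) := fun n j h => by
  classical
  rw [coeff_C]
  split_ifs with h0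
  · subst h0
    rw [Polynomial.coeff_C, if_neg]
    simp at h
    omega
  · simp

theorem TotalDegLE.prod {κ : Type*} (s : Finset κ)
    (f : κ → MvPolynomial (Fin m) (Polynomial ℂ)) (h : ∀ i ∈ s, TotalDegLE 1 (f i)) :
    TotalDegLE s.card (∏ i ∈ s, f i) := by
  classical
  induction s using Finset.induction_on with
  | empty => simpa using totalDegLE_C_C (m := m) (k := 0) 1
  | insert a s ha ih =>
    rw [Finset.prod_insert ha, Finset.card_insert_of_notMem ha, add_comm]
    exact (h a (by simp)).mul (ih fun i hi => h i (by simp [hi]))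

theorem totalDegLE_pencilDet (A : Fin m → Matrix (Fin d) (Fin d) ℂ) :
    TotalDegLE d (pencilDet A) := by
  classical
  rw [pencilDet, Matrix.det_apply]
  refine TotalDegLE.sum _ _ fun σ _ => ?_
  have hprod : TotalDegLE d (∏ i : Fin d, (Matrix.of fun a b =>
      MvPolynomial.C Polynomial.X * (if a = b then 1 else 0) +
      ∑ i, MvPolynomial.X i * MvPolynomial.C (Polynomial.C (A i a b))) (σ i) i) := by
    have := TotalDegLE.prod Finset.univ (fun i : Fin d => (Matrix.of fun a b =>
      (MvPolynomial.C Polynomial.X : MvPolynomial (Fin m) (Polynomial ℂ)) *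
        (if a = b then 1 else 0) +
      ∑ i, MvPolynomial.X i * MvPolynomial.C (Polynomial.C (A i a b))) (σ i) i) fun i _ => ?_
    · simpa using this
    · rw [Matrix.of_apply]
      refine TotalDegLE.add ?_ (TotalDegLE.sum _ _ fun j _ => ?_)
      · refine TotalDegLE.mul (k := 1) (l := 0) (fun n j h => ?_) ?_
        · rw [coeff_C]
          split_ifs with h0
          · subst h0
            rw [Polynomial.coeff_X, if_neg]
            simp at h
            omega
          · simp
        · split_ifs
          · simpa using totalDegLE_C_C (m := m) (k := 0) 1
          · simpa using totalDegLE_C_C (m := m) (k := 0) 0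
      · refine TotalDegLE.mul (k := 1) (l := 0) (fun n k h => ?_) (totalDegLE_C_C _)
        rw [MvPolynomial.coeff_X]
        split_ifs with h0
        · subst h0
          rw [Polynomial.coeff_one, if_neg]
          simp at h
          omega
        · simp
  rcases Int.units_eq_one_or (Equiv.Perm.sign σ) with hs | hs
  · simpa [hs] using hprod
  · intro n j h
    have := hprod n j h
    rw [hs]
    simp only [Units.neg_smul, one_smul, coeff_neg, Polynomial.coeff_neg, this, neg_zero]

theorem sqfreeExp_degree (T : Finset (Fin m)) : (sqfreeExp T).degree = T.card := by
  simp [sqfreeExp]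

theorem pencilCoeff_empty (A : Fin m → Matrix (Fin d) (Fin d) ℂ) :
    pencilCoeff A ∅ = Polynomial.X ^ d := by
  have : pencilCoeff A ∅ = constantCoeff (pencilDet A) := rfl
  rw [this, pencilDet, RingHom.map_det]
  have h : (constantCoeff (R := Polynomial ℂ) (σ := Fin m)).mapMatrix (Matrix.of fun a b =>
      (MvPolynomial.C Polynomial.X : MvPolynomial (Fin m) (Polynomial ℂ)) *
        (if a = b then 1 else 0) +
      ∑ i, MvPolynomial.X i * MvPolynomial.C (Polynomial.C (A i a b))) =
      Matrix.diagonal (fun _ : Fin d => Polynomial.X) := by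
    ext1 a b
    by_cases hab : a = b <;> simp [hab, Matrix.diagonal]
  rw [h, Matrix.det_diagonal]
  simp

theorem monic_mixedCharPoly (A : Fin m → Matrix (Fin d) (Fin d) ℂ) :
    (mixedCharPoly A).Monic ∧ (mixedCharPoly A).natDegree = d := by
  classical
  have hco : ∀ j, d ≤ j → (mixedCharPoly A).coeff j = if j = d then 1 else 0 := by
    intro j hj
    rw [mixedCharPoly_eq_sum, Polynomial.finsetSum_coeff, Finset.sum_eq_single ∅]
    · simp [pencilCoeff_empty, Polynomial.coeff_X_pow]
    · intro T _ hT
      have h1 : (pencilCoeff A T).coeff j = 0 := by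
        refine totalDegLE_pencilDet A _ _ ?_
        have := Finset.card_pos.2 (Finset.nonempty_iff_ne_empty.2 hT)
        rw [sqfreeExp_degree]
        omega
      rw [Finset.prod_const]
      rcases neg_one_pow_eq_or (Polynomial ℂ) T.card with h | h <;> simp [h, h1]
    · simp
  have hle : (mixedCharPoly A).natDegree ≤ d :=
    Polynomial.natDegree_le_iff_coeff_eq_zero.2 fun N hN => by
      rw [hco N hN.le, if_neg hN.ne']
  have h1 : (mixedCharPoly A).coeff d = 1 := by rw [hco d le_rfl, if_pos rfl]
  have hm : (mixedCharPoly A).Monic := Polynomial.monic_of_natDegree_le_of_coeff_eq_one d hle h1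
  exact ⟨hm, le_antisymm hle (Polynomial.le_natDegree_of_ne_zero (by simp [h1]))⟩

end MixedCoefficients

section Stability

theorem im_neg_one_div (z : ℂ) : (-(1 / z)).im = z.im / Complex.normSq z := by
  simp [Complex.inv_im]
  ring

/-- A biaffine polynomial without zeros in the closed upper half-planes has
different constant and top coefficients. -/
theorem biaffine_const_ne_top {c₀ c₁ c₂ c₃ : ℂ}
    (H : ∀ u v : ℂ, 0 ≤ u.im → 0 ≤ v.im → c₀ + c₁ * u + c₂ * v + c₃ * (u * v) ≠ 0) :
    c₀ - c₃ ≠ 0 := by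
  intro h
  obtain rfl : c₀ = c₃ := sub_eq_zero.1 h
  have hc : c₀ ≠ 0 := by simpa using H 0 0 (by simp) (by simp)
  obtain ⟨α, rfl⟩ : ∃ α, c₁ = c₀ * α := ⟨c₁ / c₀, by field_simp⟩
  obtain ⟨β, rfl⟩ : ∃ β, c₂ = c₀ * β := ⟨c₂ / c₀, by field_simp⟩
  have H' : ∀ u v : ℂ, 0 ≤ u.im → 0 ≤ v.im → 1 + α * u + β * v + u * v ≠ 0 := by
    intro u v hu hv h0
    refine H u v hu hv ?_
    linear_combination c₀ * h0
  have hβ : β.im ≤ 0 := by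
    by_contra! hb
    have hb0 : β ≠ 0 := fun h => by simp [h] at hb
    refine H' 0 (-(1 / β)) (by simp) ?_ ?_
    · rw [im_neg_one_div]
      exact div_nonneg hb.le (Complex.normSq_nonneg _)
    · field_simp
      ring
  by_cases hα0 : α = 0
  · subst hα0
    refine H' (Complex.I - β) Complex.I ?_ (by simp) ?_
    · simp only [Complex.sub_im, Complex.I_im]
      linarith
    · linear_combination Complex.I_mul_I
  rcases le_or_gt 0 α.im with hα | hα
  · refine H' (-(1 / α)) 0 ?_ (by simp) ?_
    · rw [im_neg_one_div]
      exact div_nonneg hα (Complex.normSq_nonneg _)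
    · field_simp
      ring
  · set N : ℝ := ‖α * β - 1‖ with hN
    have hN0 : 0 ≤ N := norm_nonneg _
    set r : ℝ := -α.im / (N + 1) with hr
    have hr0 : 0 < r := div_pos (by linarith) (by linarith)
    have hrC : (r : ℂ) ≠ 0 := by exact_mod_cast hr0.ne'
    refine H' (((r⁻¹ : ℝ) : ℂ) - β) (r * (α * β - 1) - α) ?_ ?_ ?_
    · simp only [Complex.sub_im, Complex.ofReal_im]
      linarith
    · have h1 : -N ≤ (α * β - 1).im := (abs_le.1 (Complex.abs_im_le_norm _)).1
      have h2 : r * (N + 1) = -α.im := by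
        rw [hr]
        field_simp
      rw [Complex.sub_im, Complex.im_ofReal_mul]
      nlinarith
    · push_cast
      field_simp
      ring

theorem biaffine_average_ne_zero {c₀ c₁ c₂ c₃ : ℂ}
    (H : ∀ u v : ℂ, 0 ≤ u.im → 0 ≤ v.im → c₀ + c₁ * u + c₂ * v + c₃ * (u * v) ≠ 0)
    {a b : ℝ} (hab : a ^ 2 ≤ b) :
    c₀ - c₁ * a + c₂ * a - c₃ * b ≠ 0 := by
  set s : ℝ := Real.sqrt (b - a ^ 2) with hs
  have hs2 : (s : ℂ) ^ 2 = b - a ^ 2 := by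
    rw [hs]
    exact_mod_cast Real.sq_sqrt (sub_nonneg.2 hab)
  have hs0 : 0 ≤ s := Real.sqrt_nonneg _
  have := biaffine_const_ne_top (c₀ := c₀ - c₁ * a + c₂ * a - c₃ * a ^ 2)
    (c₁ := s * (c₁ + c₃ * a)) (c₂ := s * (c₂ - c₃ * a)) (c₃ := s ^ 2 * c₃) ?_
  · intro h
    apply this
    rw [hs2]
    linear_combination h
  · intro u v hu hv h0
    refine H (s * u - a) (s * v + a) ?_ ?_ ?_
    · simp
      positivity
    · simp
      positivity
    · linear_combination h0

theorem eval_add_mul_derivative_ne_zero {p : Polynomial ℂ}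
    (hp : ∀ z : ℂ, 0 ≤ z.im → p.eval z ≠ 0) {u : ℂ} (hu : 0 ≤ u.im) :
    p.eval 0 + u * p.derivative.eval 0 ≠ 0 := by
  intro h
  have h0 : p.eval 0 ≠ 0 := hp 0 (by simp)
  have hS := (IsAlgClosed.splits p).eval_derivative_div_eval_of_ne_zero h0
  set S := (p.roots.map fun z => 1 / (0 - z)).sum with hSdef
  have hd : p.derivative.eval 0 = S * p.eval 0 := by
    rw [← hS]
    field_simp
  have h1 : 1 + u * S = 0 := by
    have : p.eval 0 * (1 + u * S) = 0 := by
      rw [hd] at h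
      linear_combination h
    exact (mul_eq_zero.1 this).resolve_left h0
  have hS0 : S ≠ 0 := fun h => by simp [h] at h1
  have hne : p.roots ≠ 0 := fun h => hS0 (by simp [hSdef, h])
  have him : S.im < 0 := by
    have h2 : S.im = (p.roots.map fun z => (1 / (0 - z)).im).sum := by
      rw [hSdef]
      exact (AddMonoidHom.map_multiset_sum Complex.imAddGroupHom _).trans
        (by rw [Multiset.map_map]; rfl)
    have h3 : (p.roots.map fun z => (1 / (0 - z)).im).sum < (p.roots.map fun _ => (0 : ℝ)).sum := by
      refine Multiset.sum_lt_sum_of_nonempty hne fun z hz => ?_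
      have hz' : z.im < 0 := by
        by_contra! hc
        exact hp z hc (Polynomial.isRoot_of_mem_roots hz)
      have hz0 : z ≠ 0 := fun h => by simp [h] at hz'
      rw [show (1 / (0 - z) : ℂ) = -(1 / z) by rw [zero_sub, div_neg], im_neg_one_div]
      exact div_neg_of_neg_of_pos hz' (Complex.normSq_pos.2 hz0)
    rw [h2]
    simpa using h3
  have hu' : u = -(1 / S) := by
    field_simp
    linear_combination h1
  rw [hu', im_neg_one_div] at hu
  exact absurd hu (not_le.2 (div_neg_of_neg_of_pos him (Complex.normSq_pos.2 hS0)))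

/-- Polynomials without zeros in the product of closed upper half-planes. -/
def ClosedStable {σ : Type*} (q : MvPolynomial σ ℂ) : Prop :=
  ∀ z : σ → ℂ, (∀ i, 0 ≤ (z i).im) → MvPolynomial.eval z q ≠ 0

theorem derivative_aeval_line {σ : Type*} [DecidableEq σ] (z : σ → ℂ) (i : σ)
    (q : MvPolynomial σ ℂ) :
    (aeval (fun j => Polynomial.C (z j) + if j = i then Polynomial.X else 0) q).derivative =
      aeval (fun j => Polynomial.C (z j) + if j = i then Polynomial.X else 0) (pderiv i q) := by
  induction q using MvPolynomial.induction_on with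
  | C a => simp
  | add p q hp hq => simp only [map_add, hp, hq]
  | mul_X p j hp =>
    rw [map_mul, Polynomial.derivative_mul, hp, Derivation.leibniz, map_add, smul_eq_mul,
      smul_eq_mul, map_mul, map_mul, aeval_X, pderiv_X]
    by_cases h : j = i
    · subst h
      simp
      ring
    · simp [h]
      ring

theorem ClosedStable.one_add_smul_pderiv {σ : Type*} {q : MvPolynomial σ ℂ}
    (hq : ClosedStable q) (i : σ) {u : ℂ} (hu : 0 ≤ u.im) :
    ClosedStable (q + u • pderiv i q) := by
  classical
  intro z hz
  set g : σ → Polynomial ℂ := fun j => Polynomial.C (z j) + if j = i then Polynomial.X else 0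
  have hev : ∀ (r : MvPolynomial σ ℂ) (t : ℂ), (aeval g r).eval t =
      MvPolynomial.eval (fun j => z j + if j = i then t else 0) r := by
    intro r t
    induction r using MvPolynomial.induction_on with
    | C a => simp
    | add p q hp hq => simp only [map_add, Polynomial.eval_add, hp, hq]
    | mul_X p j hp =>
      rw [map_mul, Polynomial.eval_mul, hp, map_mul, aeval_X, eval_X]
      by_cases h : j = i <;> simp [g, h]
  have := eval_add_mul_derivative_ne_zero (p := aeval g q) (fun t ht => by
    rw [hev]
    refine hq _ fun j => ?_
    split_ifs
    · simpa using add_nonneg (hz j) ht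
    · simpa using hz j) hu
  rw [derivative_aeval_line, hev, hev] at this
  simpa using this

theorem ClosedStable.sum_prod_mul_coeff_ne_zero {m : ℕ} {q : MvPolynomial (Fin m) ℂ}
    (hq : ClosedStable q) (u : Fin m → ℂ) (hu : ∀ i, 0 ≤ (u i).im) :
    ∑ T, (∏ i ∈ T, u i) * coeff (sqfreeExp T) q ≠ 0 := by
  have h1 := expand_ofFn_prod (R := ℂ) (fun i : Fin m => (pderiv i).toLinearMap) u
    (fun T => MvPolynomial.lcoeff ℂ (sqfreeExp T))
    (fun T i h r => coeff_sqfreeExp_pderiv T i h r) q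
  have h2 : ∀ l : List (Fin m), ClosedStable ((l.map fun i =>
      (1 + u i • (pderiv i).toLinearMap : Module.End ℂ (MvPolynomial (Fin m) ℂ))).prod q) := by
    intro l
    induction l with
    | nil => simpa using hq
    | cons a l ih => simpa using ih.one_add_smul_pderiv a (hu a)
  have h3 := h2 (List.finRange m) 0 (by simp)
  rw [← List.ofFn_eq_map, MvPolynomial.eval_zero] at h3
  exact fun h => h3 (h1.trans h)

/-- Functions of `(u, u')` that are affine separately in each `u i` and each `u' i`. -/
def Biaffine {m : ℕ} (K : (Fin m → ℂ) → (Fin m → ℂ) → ℂ) : Prop :=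
  ∀ i u u', ∃ c₀ c₁ c₂ c₃ : ℂ, ∀ t t', K (Function.update u i t) (Function.update u' i t') =
    c₀ + c₁ * t + c₂ * t' + c₃ * (t * t')

theorem expectation_ne_zero {m : ℕ} (S : Fin m → Type*) [∀ i, Fintype (S i)]
    (v w : ∀ i, S i → ℝ) (hw0 : ∀ i x, 0 ≤ w i x) (hw1 : ∀ i, ∑ x, w i x = 1)
    (K : (Fin m → ℂ) → (Fin m → ℂ) → ℂ) (hK : Biaffine K)
    (hK0 : ∀ u u', (∀ i, 0 ≤ (u i).im) → (∀ i, 0 ≤ (u' i).im) → K u u' ≠ 0) :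
    ∑ s : ∀ i, S i, ((∏ i, w i (s i) : ℝ) : ℂ) *
      K (fun i => -(v i (s i) : ℂ)) (fun i => (v i (s i) : ℂ)) ≠ 0 := by
  induction m with
  | zero => simpa using hK0 _ _ (by simp) (by simp)
  | succ m ih =>
    have key := ih (fun i => S i.succ) (fun i => v i.succ) (fun i => w i.succ)
      (fun i => hw0 i.succ) (fun i => hw1 i.succ)
      (fun u u' => ∑ x, (w 0 x : ℂ) * K (Fin.cons (-(v 0 x : ℂ)) u) (Fin.cons (v 0 x : ℂ) u'))
      ?_ ?_
    · rw [← (Fin.consEquiv S).sum_comp, Fintype.sum_prod_type, Finset.sum_comm]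
      convert key using 3 with s
      rw [Finset.mul_sum]
      refine Finset.sum_congr rfl fun x _ => ?_
      rw [Fin.prod_univ_succ]
      have e1 : (fun i => -(v i (Fin.consEquiv S (x, s) i) : ℂ)) =
          Fin.cons (α := fun _ => ℂ) (-(v 0 x : ℂ)) (fun i => -(v i.succ (s i) : ℂ)) := by
        ext i
        refine Fin.cases ?_ (fun j => ?_) i <;> simp [Fin.consEquiv]
      have e2 : (fun i => (v i (Fin.consEquiv S (x, s) i) : ℂ)) =
          Fin.cons (α := fun _ => ℂ) (v 0 x : ℂ) (fun i => (v i.succ (s i) : ℂ)) := by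
        ext i
        refine Fin.cases ?_ (fun j => ?_) i <;> simp [Fin.consEquiv]
      rw [e1, e2]
      simp only [Fin.consEquiv, Equiv.coe_fn_mk, Fin.cons_zero, Fin.cons_succ]
      push_cast
      ring
    · intro i u u'
      choose c₀ c₁ c₂ c₃ hc using fun x => hK i.succ (Fin.cons (-(v 0 x : ℂ)) u)
        (Fin.cons (v 0 x : ℂ) u')
      refine ⟨∑ x, w 0 x * c₀ x, ∑ x, w 0 x * c₁ x, ∑ x, w 0 x * c₂ x, ∑ x, w 0 x * c₃ x,
        fun t t' => ?_⟩
      simp only [Fin.cons_update, hc, Finset.sum_mul, ← Finset.sum_add_distrib]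
      exact Finset.sum_congr rfl fun x _ => by ring
    · intro u u' hu hu'
      obtain ⟨c₀, c₁, c₂, c₃, hc⟩ := hK 0 (Fin.cons 0 u) (Fin.cons 0 u')
      simp only [Fin.update_cons_zero] at hc
      have hcons : ∀ (t : ℂ) (y : Fin m → ℂ), 0 ≤ t.im → (∀ i, 0 ≤ (y i).im) →
          ∀ i, 0 ≤ ((Fin.cons t y : Fin (m + 1) → ℂ) i).im := by
        intro t y ht hy i
        refine Fin.cases ?_ (fun j => ?_) i
        · simpa using ht
        · simpa using hy j
      have hvar : (∑ x, w 0 x * v 0 x) ^ 2 ≤ ∑ x, w 0 x * v 0 x ^ 2 := by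
        have h := Finset.sum_nonneg fun x (_ : x ∈ Finset.univ) =>
          mul_nonneg (hw0 0 x) (sq_nonneg (v 0 x - ∑ x, w 0 x * v 0 x))
        set a := ∑ x, w 0 x * v 0 x with ha
        have h' : ∑ x, w 0 x * (v 0 x - a) ^ 2 =
            ∑ x, w 0 x * v 0 x ^ 2 - 2 * a * ∑ x, w 0 x * v 0 x + a ^ 2 * ∑ x, w 0 x := by
          simp only [Finset.mul_sum (a := 2 * a), Finset.mul_sum (a := a ^ 2),
            ← Finset.sum_sub_distrib, ← Finset.sum_add_distrib]
          exact Finset.sum_congr rfl fun x _ => by ring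
        rw [h', ← ha, hw1] at h
        linarith
      have hne := biaffine_average_ne_zero (c₀ := c₀) (c₁ := c₁) (c₂ := c₂) (c₃ := c₃)
        (fun t t' ht ht' => by
          rw [← hc]
          exact hK0 _ _ (hcons t u ht hu) (hcons t' u' ht' hu')) hvar
      convert hne using 1
      have h1 : ∑ x, (w 0 x : ℂ) = 1 := by exact_mod_cast hw1 0
      push_cast
      rw [← mul_one c₀, ← h1]
      simp only [hc, Finset.mul_sum, ← Finset.sum_sub_distrib, ← Finset.sum_add_distrib]
      exact Finset.sum_congr rfl fun x _ => by ring

end Stability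

section Main

variable {m d : ℕ}

theorem det_pencil_ne_zero (A : Fin m → Matrix (Fin d) (Fin d) ℂ)
    (hA : ∀ i, (A i).PosSemidef) {x : ℂ} (hx : 0 < x.im) (z : Fin m → ℂ)
    (hz : ∀ i, 0 ≤ (z i).im) :
    (x • (1 : Matrix (Fin d) (Fin d) ℂ) + ∑ i, z i • A i).det ≠ 0 := by
  intro h
  obtain ⟨y, hy, h0⟩ := Matrix.exists_mulVec_eq_zero_iff.2 h
  have h1 : x * (star y ⬝ᵥ y) + ∑ i, z i * (star y ⬝ᵥ (A i).mulVec y) = 0 := by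
    have := congrArg (fun t => star y ⬝ᵥ t) h0
    simpa [Matrix.add_mulVec, Matrix.sum_mulVec, Matrix.smul_mulVec, dotProduct_add,
      dotProduct_sum, dotProduct_smul] using this
  have hyy : 0 < star y ⬝ᵥ y := Matrix.dotProduct_star_self_pos_iff.2 hy
  have h2 := congrArg Complex.im h1
  have h3 : 0 < (x * (star y ⬝ᵥ y)).im := by
    obtain ⟨hr, hi⟩ := Complex.lt_def.1 hyy
    rw [Complex.mul_im, ← hi]
    simpa using mul_pos hx hr
  have h4 : ∀ i, 0 ≤ (z i * (star y ⬝ᵥ (A i).mulVec y)).im := fun i => by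
    obtain ⟨hr, hi⟩ := Complex.le_def.1 ((hA i).dotProduct_mulVec_nonneg y)
    rw [Complex.mul_im, ← hi]
    simpa using mul_nonneg (hz i) hr
  rw [Complex.add_im, Complex.im_sum, Complex.zero_im] at h2
  have := Finset.sum_nonneg fun i (_ : i ∈ Finset.univ) => h4 i
  linarith

theorem eval_map_pencilDet (A : Fin m → Matrix (Fin d) (Fin d) ℂ) (x : ℂ) (z : Fin m → ℂ) :
    MvPolynomial.eval z (MvPolynomial.map (Polynomial.evalRingHom x) (pencilDet A)) =
      (x • (1 : Matrix (Fin d) (Fin d) ℂ) + ∑ i, z i • A i).det := by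
  rw [pencilDet, RingHom.map_det, RingHom.map_det]
  congr 1
  ext1 a b
  by_cases h : a = b <;> simp [h, Matrix.sum_apply]

/-- The multiaffine part in `u` of `det(x I + ∑ u_i A_i)`. -/
noncomputable def multiaffinePart (A : Fin m → Matrix (Fin d) (Fin d) ℂ) (x : ℂ)
    (u : Fin m → ℂ) : ℂ :=
  ∑ T, (∏ i ∈ T, u i) * (pencilCoeff A T).eval x

theorem multiaffinePart_ne_zero (A : Fin m → Matrix (Fin d) (Fin d) ℂ) (x : ℂ)
    (h : ∀ z : Fin m → ℂ, (∀ i, 0 ≤ (z i).im) →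
      (x • (1 : Matrix (Fin d) (Fin d) ℂ) + ∑ i, z i • A i).det ≠ 0)
    (u : Fin m → ℂ) (hu : ∀ i, 0 ≤ (u i).im) : multiaffinePart A x u ≠ 0 := by
  have hs : ClosedStable (MvPolynomial.map (Polynomial.evalRingHom x) (pencilDet A)) :=
    fun z hz => by
      rw [eval_map_pencilDet]
      exact h z hz
  have := hs.sum_prod_mul_coeff_ne_zero u hu
  simpa only [coeff_map, multiaffinePart, pencilCoeff, Polynomial.coe_evalRingHom] using this

theorem multiaffinePart_update (A : Fin m → Matrix (Fin d) (Fin d) ℂ) (x : ℂ)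
    (i : Fin m) (u : Fin m → ℂ) :
    ∃ a b : ℂ, ∀ t, multiaffinePart A x (Function.update u i t) = a + b * t := by
  refine ⟨∑ T, (if i ∈ T then 0 else (∏ j ∈ T, u j) * (pencilCoeff A T).eval x),
    ∑ T, (if i ∈ T then (∏ j ∈ T.erase i, u j) * (pencilCoeff A T).eval x else 0), fun t => ?_⟩
  rw [multiaffinePart, Finset.sum_mul, ← Finset.sum_add_distrib]
  refine Finset.sum_congr rfl fun T _ => ?_
  split_ifs with h
  · rw [Finset.prod_update_of_mem h, Finset.sdiff_singleton_eq_erase]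
    ring
  · rw [Finset.prod_update_of_notMem h]
    ring

theorem eval_mixedCharPoly_smul (A : Fin m → Matrix (Fin d) (Fin d) ℂ) (x : ℂ)
    (t : Fin m → ℂ) :
    (mixedCharPoly fun i => t i • A i).eval x = multiaffinePart A x (fun i => -t i) := by
  rw [mixedCharPoly_eq_sum, Polynomial.eval_finsetSum, multiaffinePart]
  refine Finset.sum_congr rfl fun T _ => ?_
  rw [pencilCoeff_smul, ← mul_assoc, ← Finset.prod_mul_distrib, Polynomial.eval_mul,
    Polynomial.eval_prod]
  simp

theorem expected_mul_ne_zero (A : Fin m → Matrix (Fin d) (Fin d) ℂ) (x : ℂ)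
    (h : ∀ z : Fin m → ℂ, (∀ i, 0 ≤ (z i).im) →
      (x • (1 : Matrix (Fin d) (Fin d) ℂ) + ∑ i, z i • A i).det ≠ 0)
    (S : Fin m → Type*) [∀ i, Fintype (S i)]
    (v w : ∀ i, S i → ℝ) (hw0 : ∀ i x, 0 ≤ w i x) (hw1 : ∀ i, ∑ x, w i x = 1) :
    ∑ s : ∀ i, S i, ((∏ i, w i (s i) : ℝ) : ℂ) *
      ((mixedCharPoly fun i => (v i (s i) : ℂ) • A i).eval x *
        (mixedCharPoly fun i => (-(v i (s i)) : ℂ) • A i).eval x) ≠ 0 := by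
  have := expectation_ne_zero S v w hw0 hw1
    (fun u u' => multiaffinePart A x u * multiaffinePart A x u') ?_ ?_
  · simpa only [eval_mixedCharPoly_smul, neg_neg] using this
  · intro i u u'
    obtain ⟨a, b, hab⟩ := multiaffinePart_update A x i u
    obtain ⟨a', b', hab'⟩ := multiaffinePart_update A x i u'
    refine ⟨a * a', b * a', a * b', b * b', fun t t' => ?_⟩
    simp only [hab, hab']
    ring
  · intro u u' hu hu'
    exact mul_ne_zero (multiaffinePart_ne_zero A x h u hu) (multiaffinePart_ne_zero A x h u' hu')

theorem realRooted_expected (A : Fin m → Matrix (Fin d) (Fin d) ℂ)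
    (hA : ∀ i, (A i).PosSemidef) (S : Fin m → Type*) [∀ i, Fintype (S i)]
    (v w : ∀ i, S i → ℝ) (hw0 : ∀ i x, 0 ≤ w i x) (hw1 : ∀ i, ∑ x, w i x = 1) :
    RealRooted (∑ s : ∀ i, S i, ((∏ i, w i (s i) : ℝ) : ℂ) •
      ((mixedCharPoly fun i => (v i (s i) : ℂ) • A i) *
        (mixedCharPoly fun i => (-(v i (s i)) : ℂ) • A i))) := by
  intro x hx
  simp only [Polynomial.IsRoot.def, Polynomial.eval_finsetSum, Polynomial.eval_smul,
    Polynomial.eval_mul, smul_eq_mul] at hx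
  rcases lt_trichotomy x.im 0 with h | h | h
  · exfalso
    refine expected_mul_ne_zero (fun i => -A i) x (fun z hz => ?_) S v w hw0 hw1 ?_
    · have h1 : x • (1 : Matrix (Fin d) (Fin d) ℂ) + ∑ i, z i • -A i =
          -((-x) • (1 : Matrix (Fin d) (Fin d) ℂ) + ∑ i, z i • A i) := by
        simp only [smul_neg, Finset.sum_neg_distrib, neg_smul, neg_add, neg_neg]
      rw [h1, Matrix.det_neg]
      refine mul_ne_zero (pow_ne_zero _ (by simp)) (det_pencil_ne_zero A hA ?_ z hz)
      simpa using h
    · rw [← hx]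
      refine Finset.sum_congr rfl fun s _ => ?_
      simp only [smul_neg, neg_smul, neg_neg]
      ring
  · exact h
  · exact absurd hx (expected_mul_ne_zero A x (det_pencil_ne_zero A hA h) S v w hw0 hw1)

theorem sum_prod_weights (S : Fin m → Type*) [∀ i, Fintype (S i)] (w : ∀ i, S i → ℝ)
    (hw1 : ∀ i, ∑ x, w i x = 1) : ∑ s : ∀ i, S i, ∏ i, w i (s i) = 1 := by
  rw [← Fintype.prod_sum]
  simp [hw1]

theorem monic_expected (A : Fin m → Matrix (Fin d) (Fin d) ℂ)
    (S : Fin m → Type*) [∀ i, Fintype (S i)]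
    (v w : ∀ i, S i → ℝ) (hw1 : ∀ i, ∑ x, w i x = 1) {F : Polynomial ℂ}
    (hF : F = ∑ s : ∀ i, S i, ((∏ i, w i (s i) : ℝ) : ℂ) •
      ((mixedCharPoly fun i => (v i (s i) : ℂ) • A i) *
        (mixedCharPoly fun i => (-(v i (s i)) : ℂ) • A i))) :
    F.Monic ∧ F.natDegree = 2 * d := by
  set f : (∀ i, S i) → Polynomial ℂ := fun s =>
    (mixedCharPoly fun i => (v i (s i) : ℂ) • A i) *
        (mixedCharPoly fun i => (-(v i (s i)) : ℂ) • A i) with hf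
  have hm : ∀ s, (f s).Monic ∧ (f s).natDegree = 2 * d := fun s => by
    have h1 := monic_mixedCharPoly fun i => (v i (s i) : ℂ) • A i
    have h2 := monic_mixedCharPoly fun i => (-(v i (s i)) : ℂ) • A i
    refine ⟨h1.1.mul h2.1, ?_⟩
    rw [hf, h1.1.natDegree_mul h2.1, h1.2, h2.2, two_mul]
  have hle : F.natDegree ≤ 2 * d := by
    rw [hF]
    exact Polynomial.natDegree_sum_le_of_forall_le _ _ fun s _ =>
      (Polynomial.natDegree_smul_le _ _).trans (hm s).2.le
  have h1 : F.coeff (2 * d) = 1 := by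
    rw [hF, Polynomial.finsetSum_coeff]
    have : ∀ s, ((((∏ i, w i (s i) : ℝ) : ℂ) • f s).coeff (2 * d)) =
        ((∏ i, w i (s i) : ℝ) : ℂ) := fun s => by
      rw [Polynomial.coeff_smul, ← (hm s).2, Polynomial.coeff_natDegree, (hm s).1.leadingCoeff,
        smul_eq_mul, mul_one]
    rw [Finset.sum_congr rfl fun s _ => this s]
    exact_mod_cast sum_prod_weights S w hw1
  exact ⟨Polynomial.monic_of_natDegree_le_of_coeff_eq_one _ hle h1,
    le_antisymm hle (Polynomial.le_natDegree_of_ne_zero (by simp [h1]))⟩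

theorem expected_monomials (S : Fin m → Type*) [∀ i, Fintype (S i)]
    (v w : ∀ i, S i → ℝ) (hw1 : ∀ i, ∑ x, w i x = 1) (hmean : ∀ i, ∑ x, w i x * v i x = 0)
    (T U : Finset (Fin m)) :
    ∑ s : ∀ i, S i, (∏ i, w i (s i)) * ((∏ i ∈ T, -v i (s i)) * ∏ i ∈ U, v i (s i)) =
      if T = U then ∏ i ∈ T, -(∑ x, w i x * v i x ^ 2) else 0 := by
  have h : ∀ s : ∀ i, S i,
      (∏ i, w i (s i)) * ((∏ i ∈ T, -v i (s i)) * ∏ i ∈ U, v i (s i)) =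
      ∏ i, (w i (s i) * ((if i ∈ T then -v i (s i) else 1) *
        (if i ∈ U then v i (s i) else 1))) := fun s => by
    rw [Finset.prod_mul_distrib, Finset.prod_mul_distrib, Fintype.prod_ite_mem,
      Fintype.prod_ite_mem]
  simp only [h]
  rw [← Fintype.prod_sum fun i x => w i x * ((if i ∈ T then -v i x else 1) *
        (if i ∈ U then v i x else 1))]
  split_ifs with hTU
  · subst hTU
    rw [← Fintype.prod_ite_mem T fun i => -(∑ x, w i x * v i x ^ 2)]
    refine Finset.prod_congr rfl fun i _ => ?_
    by_cases hi : i ∈ T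
    · simp only [hi, if_true, ← Finset.sum_neg_distrib]
      exact Finset.sum_congr rfl fun x _ => by ring
    · simp [hi, hw1]
  · obtain ⟨i, hi⟩ : ∃ i, ¬(i ∈ T ↔ i ∈ U) := by
      by_contra! hc
      exact hTU (Finset.ext hc)
    refine Finset.prod_eq_zero (Finset.mem_univ i) ?_
    by_cases h1 : i ∈ T <;> by_cases h2 : i ∈ U <;> simp_all

theorem expected_eq_quadMixedCharPoly (A : Fin m → Matrix (Fin d) (Fin d) ℂ)
    (S : Fin m → Type*) [∀ i, Fintype (S i)]
    (v w : ∀ i, S i → ℝ) (hw0 : ∀ i x, 0 ≤ w i x) (hw1 : ∀ i, ∑ x, w i x = 1)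
    (hmean : ∀ i, ∑ x, w i x * v i x = 0) :
    ∑ s : ∀ i, S i, ((∏ i, w i (s i) : ℝ) : ℂ) •
      ((mixedCharPoly fun i => (v i (s i) : ℂ) • A i) *
        (mixedCharPoly fun i => (-(v i (s i)) : ℂ) • A i)) =
      quadMixedCharPoly fun i => ((Real.sqrt (∑ x, w i x * v i x ^ 2) : ℝ) : ℂ) • A i := by
  refine Polynomial.funext fun x => ?_
  have hR : (quadMixedCharPoly fun i =>
      ((Real.sqrt (∑ x, w i x * v i x ^ 2) : ℝ) : ℂ) • A i).eval x =
      ∑ T : Finset (Fin m), ((∏ i ∈ T, -(∑ x, w i x * v i x ^ 2) : ℝ) : ℂ) *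
        ((pencilCoeff A T).eval x * (pencilCoeff A T).eval x) := by
    rw [quadMixedCharPoly_eq_sum, Polynomial.eval_finsetSum]
    refine Finset.sum_congr rfl fun T _ => ?_
    have hsq : ∀ i, (((∑ x, w i x * v i x ^ 2 : ℝ)) : ℂ) =
        (Real.sqrt (∑ x, w i x * v i x ^ 2) : ℂ) * (Real.sqrt (∑ x, w i x * v i x ^ 2) : ℂ) :=
      fun i => by
        exact_mod_cast (Real.mul_self_sqrt (Finset.sum_nonneg fun x _ =>
          mul_nonneg (hw0 i x) (sq_nonneg _))).symm
    rw [pencilCoeff_smul, Complex.ofReal_prod]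
    simp only [Complex.ofReal_neg, hsq, Polynomial.eval_mul, Polynomial.eval_prod,
      Polynomial.eval_C, Polynomial.eval_neg, Polynomial.eval_one]
    simp only [Finset.prod_neg, Finset.prod_const, Finset.prod_mul_distrib, one_pow]
    ring
  rw [hR]
  simp only [Polynomial.eval_finsetSum, Polynomial.eval_smul, Polynomial.eval_mul,
    eval_mixedCharPoly_smul, neg_neg, smul_eq_mul, multiaffinePart]
  have hE : ∀ s : ∀ i, S i, ((∏ i, w i (s i) : ℝ) : ℂ) *
      ((∑ T, (∏ i ∈ T, -(v i (s i) : ℂ)) * (pencilCoeff A T).eval x) *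
        ∑ U, (∏ i ∈ U, (v i (s i) : ℂ)) * (pencilCoeff A U).eval x) =
      ∑ T, ∑ U, (((∏ i, w i (s i)) * ((∏ i ∈ T, -v i (s i)) * ∏ i ∈ U, v i (s i)) : ℝ) : ℂ) *
        ((pencilCoeff A T).eval x * (pencilCoeff A U).eval x) := fun s => by
    rw [Finset.sum_mul_sum, Finset.mul_sum]
    refine Finset.sum_congr rfl fun T _ => ?_
    rw [Finset.mul_sum]
    refine Finset.sum_congr rfl fun U _ => ?_
    push_cast
    ring
  rw [Finset.sum_congr rfl fun s _ => hE s, Finset.sum_comm]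
  refine Finset.sum_congr rfl fun T _ => ?_
  rw [Finset.sum_comm]
  simp only [← Finset.sum_mul, ← Complex.ofReal_sum, expected_monomials S v w hw1 hmean]
  rw [Finset.sum_eq_single T (fun U _ hU => by simp [hU.symm]) (by simp), if_pos rfl]

end Main

end Auxiliary

/-- the expected polynomial
`E[μ[ξ_1 A_1,…,ξ_m A_m]·μ[−ξ_1 A_1,…,−ξ_m A_m]]` is monic, real-rooted, of degree `2d`,
and for mean-zero `ξ_i` it equals `μ₂[Var(ξ_1)^{1/2} A_1,…,Var(ξ_m)^{1/2} A_m]`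
(Lemma `muxx`).  The jointly independent finitely-valued random variables `ξ_i` are
encoded by finite value tables `v i : S i → ℝ` with probability weights `w i`, so that
`E[ξ_i] = ∑ x, w i x * v i x`, `Var(ξ_i) = E[ξ_i²] − E[ξ_i]²`, and the expected
polynomial is `F = ∑_s (∏ i, w i (s i)) • (μ[v(s) A]·μ[−v(s) A])`. -/
theorem statement18 {m d : ℕ} (A : Fin m → Matrix (Fin d) (Fin d) ℂ)
    (hA : ∀ i, (A i).PosSemidef)
    (S : Fin m → Type*) [∀ i, Fintype (S i)] [∀ i, Nonempty (S i)]
    (v w : ∀ i, S i → ℝ)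
    (hw0 : ∀ i x, 0 ≤ w i x) (hw1 : ∀ i, ∑ x, w i x = 1)
    (F : Polynomial ℂ)
    (hF : F = ∑ s : ∀ i, S i, ((∏ i, w i (s i) : ℝ) : ℂ) •
      ((mixedCharPoly fun i => (v i (s i) : ℂ) • A i) *
        (mixedCharPoly fun i => (-(v i (s i)) : ℂ) • A i))) :
    F.Monic ∧ F.natDegree = 2 * d ∧ RealRooted F ∧
    ((∀ i, ∑ x, w i x * v i x = 0) →
      F = quadMixedCharPoly fun i =>
        ((Real.sqrt (∑ x, w i x * v i x ^ 2) : ℝ) : ℂ) • A i) := by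
  subst hF
  obtain ⟨hm, hd⟩ := monic_expected A S v w hw1 rfl
  exact ⟨hm, hd, realRooted_expected A hA S v w hw0 hw1,
    expected_eq_quadMixedCharPoly A S v w hw0 hw1⟩
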